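/- arXiv:1010.4530 — 2 statements merged into one kernel-verified Lean document; each statement's English description precedes it below -/
import Mathlib

section
/- Henry's inequality: Let T > 0, a ≥ 0, b ≥ 0, β > 0, and let u : [0,T) → [0,∞) be a locally integrable function satisfying u(t) ≤ a + b ∫₀^t (t−s)^{β−1} u(s) ds for all t ∈ [0,T). Then u(t) ≤ a · G_β(θ t) for all t ∈ [0,T), where θ = (b Γ(β))^{1/β} and G_β(z) = Σ_{n≥0} z^{nβ} / Γ(nβ + 1). -/
open Real MeasureTheory

open scoped ENNReal

/-- The Riemann–Liouville kernel `x ↦ x ^ (α - 1) / Γ(α)` on the positive half-line, extended by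
zero. -/
noncomputable def rlKernel (α x : ℝ) : ℝ≥0∞ :=
  ENNReal.ofReal (if 0 < x then x ^ (α - 1) / Real.Gamma α else 0)

lemma rlKernel_of_pos {α x : ℝ} (hx : 0 < x) :
    rlKernel α x = ENNReal.ofReal (x ^ (α - 1) / Real.Gamma α) := by
  simp [rlKernel, hx]

lemma rlKernel_of_nonpos {α x : ℝ} (hx : x ≤ 0) : rlKernel α x = 0 := by
  simp [rlKernel, hx.not_gt]

lemma measurable_rlKernel (α : ℝ) : Measurable (rlKernel α) :=
  (Measurable.ite measurableSet_Ioi (by fun_prop) (by fun_prop)).ennreal_ofReal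

lemma rlKernel_mul_rlKernel {α β x : ℝ} (hα : 0 < α) (hβ : 0 < β) (hx : 0 < x) (z : ℝ) :
    ENNReal.ofReal x * (rlKernel α (x * z) * rlKernel β (-(x * z) + x)) =
      rlKernel (α + β) x * ProbabilityTheory.betaPDF α β z := by
  rcases le_or_gt z 0 with hz | hz
  · rw [rlKernel_of_nonpos (mul_nonpos_of_nonneg_of_nonpos hx.le hz),
      ProbabilityTheory.betaPDF_eq_zero_of_nonpos hz]
    simp
  rcases le_or_gt 1 z with hz1 | hz1
  · rw [rlKernel_of_nonpos (x := -(x * z) + x) (by nlinarith),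
      ProbabilityTheory.betaPDF_eq_zero_of_one_le hz1]
    simp
  have h1 : 0 < 1 - z := by linarith
  have e : -(x * z) + x = x * (1 - z) := by ring
  have hΓα := Real.Gamma_pos_of_pos hα
  have hΓβ := Real.Gamma_pos_of_pos hβ
  have hΓαβ := Real.Gamma_pos_of_pos (add_pos hα hβ)
  rw [e, rlKernel_of_pos (mul_pos hx hz), rlKernel_of_pos (mul_pos hx h1), rlKernel_of_pos hx,
    ProbabilityTheory.betaPDF_of_pos_lt_one hz hz1, ← ENNReal.ofReal_mul (by positivity),
    ← ENNReal.ofReal_mul (by positivity), ← ENNReal.ofReal_mul (by positivity)]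
  congr 1
  have hpow : x ^ (α + β - 1) = x * x ^ (α - 1) * x ^ (β - 1) := by
    nth_rewrite 2 [← Real.rpow_one x]
    rw [← Real.rpow_add hx, ← Real.rpow_add hx]
    ring_nf
  rw [Real.mul_rpow hx.le hz.le, Real.mul_rpow hx.le h1.le, hpow, ProbabilityTheory.beta]
  field_simp

lemma rlKernel_lconvolution_rlKernel {α β : ℝ} (hα : 0 < α) (hβ : 0 < β) :
    rlKernel α ⋆ₗ rlKernel β = rlKernel (α + β) := by
  ext x
  rw [lconvolution_def]
  rcases le_or_gt x 0 with hx | hx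
  · rw [rlKernel_of_nonpos hx]
    refine (lintegral_congr fun y ↦ ?_).trans lintegral_zero
    rcases le_or_gt y 0 with hy | hy
    · simp [rlKernel_of_nonpos hy]
    · simp [rlKernel_of_nonpos (x := -y + x) (by linarith)]
  · have hm : Measurable fun y ↦ rlKernel α y * rlKernel β (-y + x) :=
      (measurable_rlKernel α).mul ((measurable_rlKernel β).comp (by fun_prop))
    rw [← Real.smul_map_volume_mul_left hx.ne', lintegral_smul_measure,
      lintegral_map hm (by fun_prop), abs_of_pos hx, smul_eq_mul,
      ← lintegral_const_mul' _ _ ENNReal.ofReal_ne_top]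
    simp_rw [rlKernel_mul_rlKernel hα hβ hx]
    rw [lintegral_const_mul' _ _ (by simp [rlKernel]),
      ProbabilityTheory.lintegral_betaPDF_eq_one hα hβ, mul_one]

lemma rpow_mul_exp_neg_le_Gamma {c y : ℝ} (hc : 0 < c) (hy : 1 ≤ y) :
    c ^ (y - 1) * Real.exp (-c) ≤ Real.Gamma y := by
  have hint := Real.GammaIntegral_convergent (s := y) (by linarith)
  rw [Real.Gamma_eq_integral (by linarith), ← integral_exp_neg_Ioi c, ← integral_const_mul]
  refine (setIntegral_mono_on ((integrableOn_exp_neg_Ioi c).const_mul _)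
    (hint.mono_set (Set.Ioi_subset_Ioi hc.le)) measurableSet_Ioi fun x hx ↦ ?_).trans
    (setIntegral_mono_set hint ?_ (Set.Ioi_subset_Ioi hc.le).eventuallyLE)
  · rw [mul_comm]
    gcongr
    exact hx.le
  · filter_upwards [ae_restrict_mem measurableSet_Ioi] with x hx
    have : (0 : ℝ) < x := hx
    simp only [Pi.zero_apply]
    positivity

lemma exists_pow_div_Gamma_le {x β : ℝ} (hx : 0 ≤ x) (hβ : 0 < β) (δ : ℝ) :
    ∃ K : ℝ, ∀ n : ℕ, 1 ≤ n * β + δ →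
      x ^ n / Real.Gamma (n * β + δ) ≤ K * (1 / 2) ^ n := by
  set C := (2 * x + 1) ^ (1 / β) with hC
  have hC0 : 0 < C := by positivity
  have hCβ : C ^ β = 2 * x + 1 := by
    rw [hC, ← Real.rpow_mul (by positivity), one_div_mul_cancel hβ.ne', Real.rpow_one]
  refine ⟨(C ^ (δ - 1) * Real.exp (-C))⁻¹, fun n hn ↦ ?_⟩
  have hpow : C ^ (n * β + δ - 1) = (2 * x + 1) ^ n * C ^ (δ - 1) := by
    rw [add_sub_assoc, Real.rpow_add hC0, mul_comm (n : ℝ), Real.rpow_mul hC0.le, hCβ,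
      Real.rpow_natCast]
  have hΓ := rpow_mul_exp_neg_le_Gamma hC0 hn
  rw [hpow] at hΓ
  have hratio : x ^ n / (2 * x + 1) ^ n ≤ (1 / 2) ^ n := by
    rw [← div_pow]
    refine pow_le_pow_left₀ (by positivity) ?_ n
    rw [div_le_div_iff₀ (by positivity) (by norm_num)]
    linarith
  calc x ^ n / Real.Gamma (n * β + δ)
      ≤ x ^ n / ((2 * x + 1) ^ n * C ^ (δ - 1) * Real.exp (-C)) := by gcongr
    _ = (C ^ (δ - 1) * Real.exp (-C))⁻¹ * (x ^ n / (2 * x + 1) ^ n) := by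
      field_simp
    _ ≤ _ := by gcongr

lemma summable_pow_div_Gamma {x β : ℝ} (hx : 0 ≤ x) (hβ : 0 < β) :
    Summable fun n : ℕ ↦ x ^ n / Real.Gamma (n * β + 1) := by
  obtain ⟨K, hK⟩ := exists_pow_div_Gamma_le hx hβ 1
  refine Summable.of_nonneg_of_le (fun n ↦ ?_) (fun n ↦ hK n ?_)
    (summable_geometric_two.mul_left K)
  · have := Real.Gamma_pos_of_pos (s := n * β + 1) (by positivity)
    positivity
  · have : 0 ≤ (n : ℝ) * β := by positivity
    linarith

lemma le_sum_rlKernel_add_lconvolution {f : ℝ → ℝ≥0∞} (hf : AEMeasurable f) {A B : ℝ≥0∞}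
    {β : ℝ} (hβ : 0 < β)
    (h : ∀ s, f s ≤ A * rlKernel 1 s + B * (rlKernel β ⋆ₗ f) s) (n : ℕ) (s : ℝ) :
    f s ≤ ∑ j ∈ Finset.range (n + 1), A * B ^ j * rlKernel (j * β + 1) s
      + B ^ (n + 1) * (rlKernel ((n + 1 : ℕ) * β) ⋆ₗ f) s := by
  induction n with
  | zero => simpa using h s
  | succ n ih =>
    have hα : 0 < ((n + 1 : ℕ) : ℝ) * β := by positivity
    set α := ((n + 1 : ℕ) : ℝ) * β
    have hadd : ((n + 1 + 1 : ℕ) : ℝ) * β = α + β := by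
      simp only [α]
      push_cast
      ring
    have hk (γ : ℝ) : AEMeasurable (rlKernel γ) := (measurable_rlKernel γ).aemeasurable
    have hstep : (rlKernel α ⋆ₗ f) s ≤
        A * rlKernel (α + 1) s + B * (rlKernel (α + β) ⋆ₗ f) s := by
      rw [← rlKernel_lconvolution_rlKernel hα hβ, ← lconvolution_assoc₀ (hk _) (hk _) hf,
        ← rlKernel_lconvolution_rlKernel hα one_pos]
      have hm1 : Measurable fun y ↦ rlKernel α y * rlKernel 1 (-y + s) :=
        (measurable_rlKernel α).mul ((measurable_rlKernel 1).comp (by fun_prop))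
      have hconv : AEMeasurable (rlKernel β ⋆ₗ f) := aemeasurable_lconvolution (hk _) hf
      have hm2 : AEMeasurable fun y ↦ rlKernel α y * (rlKernel β ⋆ₗ f) (-y + s) :=
        (hk _).mul (by fun_prop)
      rw [lconvolution_def, lconvolution_def (f := rlKernel α) (g := rlKernel 1),
        lconvolution_def (f := rlKernel α) (g := rlKernel β ⋆ₗ f),
        ← lintegral_const_mul _ hm1, ← lintegral_const_mul'' _ hm2,
        ← lintegral_add_left (hm1.const_mul _)]
      refine lintegral_mono fun y ↦ ?_
      calc rlKernel α y * f (-y + s)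
          ≤ rlKernel α y * (A * rlKernel 1 (-y + s) + B * (rlKernel β ⋆ₗ f) (-y + s)) := by
            gcongr
            exact h _
        _ = _ := by ring
    refine ih.trans ?_
    rw [Finset.sum_range_succ _ (n + 1), add_assoc, hadd]
    gcongr
    calc B ^ (n + 1) * (rlKernel α ⋆ₗ f) s
        ≤ B ^ (n + 1) * (A * rlKernel (α + 1) s + B * (rlKernel (α + β) ⋆ₗ f) s) := by gcongr
      _ = _ := by ring

lemma lconvolution_rlKernel_le {f : ℝ → ℝ≥0∞} {α t : ℝ} (hα : 1 ≤ α)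
    (hf : ∀ s ≤ 0, f s = 0) :
    (rlKernel α ⋆ₗ f) t ≤ ENNReal.ofReal (t ^ (α - 1) / Real.Gamma α) * ∫⁻ s, f s := by
  have hΓ := Real.Gamma_pos_of_pos (zero_lt_one.trans_le hα)
  rw [lconvolution_comm, lconvolution_def, ← lintegral_const_mul' _ _ ENNReal.ofReal_ne_top]
  refine lintegral_mono fun s ↦ ?_
  rcases le_or_gt s 0 with hs | hs
  · simp [hf s hs]
  rcases le_or_gt (-s + t) 0 with hst | hst
  · simp [rlKernel_of_nonpos hst]
  rw [rlKernel_of_pos hst, mul_comm]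
  gcongr
  linarith

lemma ofReal_le_rlKernel_lconvolution {a b β t : ℝ} (hb : 0 ≤ b) (hβ : 0 < β)
    {u : ℝ → ℝ} (hu_nonneg : ∀ s, 0 ≤ u s)
    (hu : ∀ s ∈ Set.Ioc 0 t, u s ≤ a + b * ∫ r in (0 : ℝ)..s, (s - r) ^ (β - 1) * u r) (s : ℝ) :
    (Set.Ioc 0 t).indicator (fun r ↦ ENNReal.ofReal (u r)) s ≤
      ENNReal.ofReal a * rlKernel 1 s + ENNReal.ofReal (b * Real.Gamma β) *
        (rlKernel β ⋆ₗ (Set.Ioc 0 t).indicator (fun r ↦ ENNReal.ofReal (u r))) s := by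
  by_cases hs : s ∈ Set.Ioc 0 t
  swap
  · simp [hs]
  have hΓ := Real.Gamma_pos_of_pos hβ
  rw [Set.indicator_of_mem hs, ENNReal.ofReal_mul hb, mul_assoc]
  have hint : ENNReal.ofReal (∫ r in (0 : ℝ)..s, (s - r) ^ (β - 1) * u r) ≤
      ENNReal.ofReal (Real.Gamma β) *
        (rlKernel β ⋆ₗ (Set.Ioc 0 t).indicator (fun r ↦ ENNReal.ofReal (u r))) s := by
    rw [intervalIntegral.integral_of_le hs.1.le, ← restrict_Ioo_eq_restrict_Ioc,
      lconvolution_comm, lconvolution_def, ← lintegral_const_mul' _ _ ENNReal.ofReal_ne_top]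
    refine (Real.ofReal_le_enorm _).trans ((enorm_integral_le_lintegral_enorm _).trans ?_)
    refine (setLIntegral_mono' measurableSet_Ioo fun r hr ↦ ?_).trans (setLIntegral_le_lintegral _ _)
    have hsr : 0 < s - r := sub_pos.2 hr.2
    have hur := hu_nonneg r
    have hmem : r ∈ Set.Ioc 0 t := ⟨hr.1, hr.2.le.trans hs.2⟩
    rw [Real.enorm_of_nonneg (by positivity), Set.indicator_of_mem hmem, ← sub_eq_neg_add,
      rlKernel_of_pos hsr, ← ENNReal.ofReal_mul hur, ← ENNReal.ofReal_mul hΓ.le]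
    refine le_of_eq (congrArg _ ?_)
    field_simp
  calc ENNReal.ofReal (u s)
      ≤ ENNReal.ofReal (a + b * ∫ r in (0 : ℝ)..s, (s - r) ^ (β - 1) * u r) :=
        ENNReal.ofReal_le_ofReal (hu s hs)
    _ ≤ ENNReal.ofReal a + ENNReal.ofReal (b * ∫ r in (0 : ℝ)..s, (s - r) ^ (β - 1) * u r) :=
        ENNReal.ofReal_add_le
    _ ≤ _ := by
        rw [ENNReal.ofReal_mul hb, rlKernel_of_pos hs.1]
        simp only [sub_self, Real.rpow_zero, Real.Gamma_one, div_one, ENNReal.ofReal_one, mul_one]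
        gcongr

theorem le_mul_tsum_of_le_add_integral {a b β t : ℝ} (ha : 0 ≤ a) (hb : 0 ≤ b) (hβ : 0 < β)
    (ht : 0 < t) {u : ℝ → ℝ} (hu_nonneg : ∀ s, 0 ≤ u s) (hu_int : IntervalIntegrable u volume 0 t)
    (hu : ∀ s ∈ Set.Ioc 0 t, u s ≤ a + b * ∫ r in (0 : ℝ)..s, (s - r) ^ (β - 1) * u r) :
    u t ≤ a * ∑' n : ℕ, (b * Real.Gamma β * t ^ β) ^ n / Real.Gamma (n * β + 1) := by
  have hΓ := Real.Gamma_pos_of_pos hβ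
  set x := b * Real.Gamma β * t ^ β with hxdef
  have hx : 0 ≤ x := by positivity
  set S := ∑' n : ℕ, x ^ n / Real.Gamma (n * β + 1) with hS
  have hterm (n : ℕ) : 0 ≤ x ^ n / Real.Gamma (n * β + 1) := by
    have := Real.Gamma_pos_of_pos (s := n * β + 1) (by positivity)
    positivity
  have hxpow (n : ℕ) : (b * Real.Gamma β) ^ n * t ^ (n * β) = x ^ n := by
    rw [hxdef, mul_pow (b * Real.Gamma β), mul_comm (n : ℝ), Real.rpow_mul ht.le, Real.rpow_natCast]
  set f := (Set.Ioc 0 t).indicator (fun r ↦ ENNReal.ofReal (u r)) with hfdef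
  have hint : IntegrableOn u (Set.Ioc 0 t) := hu_int.1
  have hf : AEMeasurable f :=
    (aemeasurable_indicator_iff measurableSet_Ioc).2 hint.aemeasurable.ennreal_ofReal
  have hf0 : ∀ s ≤ 0, f s = 0 := fun s hs ↦
    Set.indicator_of_notMem (fun h ↦ hs.not_gt h.1) _
  have hI : ∫⁻ s, f s ≠ ∞ := by
    rw [lintegral_indicator measurableSet_Ioc]
    exact hint.lintegral_lt_top.ne
  set I := ∫⁻ s, f s
  obtain ⟨K, hK⟩ := exists_pow_div_Gamma_le hx hβ 0
  have hbound : ∀ᶠ n : ℕ in Filter.atTop, ENNReal.ofReal (u t) ≤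
      ENNReal.ofReal (a * S) + ENNReal.ofReal (K * (1 / 2) ^ (n + 1) / t) * I := by
    obtain ⟨N, hN⟩ := exists_nat_ge (1 / β)
    filter_upwards [Filter.eventually_ge_atTop N] with n hn
    have hα : 1 ≤ ((n + 1 : ℕ) : ℝ) * β := by
      rw [← div_le_iff₀ hβ]
      exact hN.trans (by exact_mod_cast hn.trans n.le_succ)
    have hmain := le_sum_rlKernel_add_lconvolution hf hβ
      (ofReal_le_rlKernel_lconvolution hb hβ hu_nonneg hu) n t
    rw [hfdef, Set.indicator_of_mem (Set.right_mem_Ioc.2 ht), ← hfdef] at hmain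
    refine hmain.trans (add_le_add ?_ ?_)
    · have hj (j : ℕ) : ENNReal.ofReal a * ENNReal.ofReal (b * Real.Gamma β) ^ j *
          rlKernel (j * β + 1) t =
          ENNReal.ofReal (a * (x ^ j / Real.Gamma (j * β + 1))) := by
        rw [rlKernel_of_pos ht, ← ENNReal.ofReal_pow (by positivity), ← ENNReal.ofReal_mul ha,
          ← ENNReal.ofReal_mul (by positivity), add_sub_cancel_right, ← hxpow]
        ring_nf
      simp_rw [hj]
      rw [← ENNReal.ofReal_sum_of_nonneg fun j _ ↦ mul_nonneg ha (hterm j), ← Finset.mul_sum]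
      gcongr
      exact (summable_pow_div_Gamma hx hβ).sum_le_tsum _ fun j _ ↦ hterm j
    · refine (mul_le_mul_right (lconvolution_rlKernel_le hα hf0) _).trans ?_
      rw [← mul_assoc, ← ENNReal.ofReal_pow (by positivity), ← ENNReal.ofReal_mul (by positivity)]
      gcongr
      have := hK (n + 1) (by simpa using hα)
      rw [add_zero, ← hxpow] at this
      rw [Real.rpow_sub ht, Real.rpow_one, le_div_iff₀ ht]
      refine le_trans (le_of_eq ?_) this
      field_simp
  have hlim : Filter.Tendsto (fun n : ℕ ↦ ENNReal.ofReal (a * S) +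
      ENNReal.ofReal (K * (1 / 2) ^ (n + 1) / t) * I) Filter.atTop
      (nhds (ENNReal.ofReal (a * S))) := by
    have h1 : Filter.Tendsto (fun n : ℕ ↦ K * (1 / 2 : ℝ) ^ (n + 1) / t) Filter.atTop
        (nhds 0) := by
      simpa using (((tendsto_pow_atTop_nhds_zero_of_lt_one (r := (1 / 2 : ℝ)) (by norm_num)
        (by norm_num)).comp (Filter.tendsto_add_atTop_nat 1)).const_mul K).div_const t
    have h2 := ENNReal.Tendsto.mul_const (ENNReal.tendsto_ofReal h1) (Or.inr hI)
    simpa using h2.const_add (ENNReal.ofReal (a * S))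
  exact (ENNReal.ofReal_le_ofReal_iff (mul_nonneg ha (tsum_nonneg hterm))).1
    (ge_of_tendsto hlim hbound)

theorem stmt3 (T a b β : ℝ) (hT : 0 < T) (ha : 0 ≤ a) (hb : 0 ≤ b) (hβ : 0 < β)
    (u : ℝ → ℝ) (hu_nonneg : ∀ t, 0 ≤ u t)
    (hu_int : ∀ t ∈ Set.Ico (0 : ℝ) T, IntervalIntegrable u volume 0 t)
    (hu : ∀ t ∈ Set.Ico (0 : ℝ) T,
      u t ≤ a + b * ∫ s in (0 : ℝ)..t, (t - s) ^ (β - 1) * u s) :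
    ∀ t ∈ Set.Ico (0 : ℝ) T,
      u t ≤ a * ∑' n : ℕ,
        ((b * Real.Gamma β) ^ (1 / β) * t) ^ ((n : ℝ) * β) / Real.Gamma ((n : ℝ) * β + 1) := by
  intro t ht
  have hΓ := Real.Gamma_pos_of_pos hβ
  have hpow (n : ℕ) : ((b * Real.Gamma β) ^ (1 / β) * t) ^ ((n : ℝ) * β) =
      (b * Real.Gamma β * t ^ β) ^ n := by
    have h0 : 0 ≤ (b * Real.Gamma β) ^ (1 / β) := by positivity
    rw [mul_comm (n : ℝ), Real.rpow_mul (mul_nonneg h0 ht.1), Real.rpow_natCast,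
      Real.mul_rpow h0 ht.1, ← Real.rpow_mul (by positivity), one_div_mul_cancel hβ.ne',
      Real.rpow_one]
  simp_rw [hpow]
  rcases ht.1.eq_or_lt with rfl | ht0
  · have h0 := hu 0 ht
    rw [tsum_eq_single 0 fun n hn ↦ by simp [Real.zero_rpow hβ.ne', hn]]
    simpa using h0
  · exact le_mul_tsum_of_le_add_integral ha hb hβ ht0 hu_nonneg (hu_int t ht)
      fun s hs ↦ hu s ⟨hs.1.le, hs.2.trans_lt ht.2⟩
end

section
/- Let H be a Hilbert space, (e^{tA})_{t≥0} a strongly continuous semigroup of compact operators on H for t > 0, and define R : L²(0,1; H) → H by R φ = ∫₀¹ e^{As} φ(s) ds. Then R is a compact linear operator. -/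
open MeasureTheory

section OperatorFamily

variable {α E F : Type*} [MeasurableSpace α] {ν : Measure α}
  [NormedAddCommGroup E] [NormedSpace ℝ E]
  [NormedAddCommGroup F] [NormedSpace ℝ F]

/-- Cauchy–Schwarz bound for the integral of a bounded family of operators applied to an `L²`
function. -/
theorem norm_integral_clm_family_apply_le [IsFiniteMeasure ν] {V : α → E →L[ℝ] F} {M : ℝ}
    (hM0 : 0 ≤ M) (hM : ∀ᵐ s ∂ν, ‖V s‖ ≤ M) {φ : α → E} (hφ : MemLp φ 2 ν) :
    ‖∫ s, V s (φ s) ∂ν‖ ≤ M * (ν.real Set.univ ^ (1 / 2 : ℝ) * (eLpNorm φ 2 ν).toReal) := by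
  have hint : Integrable φ ν := hφ.integrable one_le_two
  have hCS : ∫ s, ‖φ s‖ ∂ν ≤ ν.real Set.univ ^ (1 / 2 : ℝ) * (eLpNorm φ 2 ν).toReal := by
    have h := eLpNorm_le_eLpNorm_mul_rpow_measure_univ (p := 1) (q := 2) one_le_two
      hφ.aestronglyMeasurable
    have h' := ENNReal.toReal_mono
      (ENNReal.mul_ne_top hφ.eLpNorm_ne_top
        (ENNReal.rpow_ne_top_of_nonneg (by norm_num) (measure_ne_top ν _))) h
    rw [eLpNorm_one_eq_lintegral_enorm, ← integral_norm_eq_lintegral_enorm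
      hφ.aestronglyMeasurable, ENNReal.toReal_mul, ← ENNReal.toReal_rpow, mul_comm] at h'
    norm_num at h'
    exact h'
  calc ‖∫ s, V s (φ s) ∂ν‖ ≤ ∫ s, M * ‖φ s‖ ∂ν := by
        refine norm_integral_le_of_norm_le (hint.norm.const_mul M) ?_
        filter_upwards [hM] with s hs
        exact (V s).le_of_opNorm_le hs _
    _ = M * ∫ s, ‖φ s‖ ∂ν := integral_const_mul _ _
    _ ≤ _ := by gcongr

variable [MeasurableSpace E] [BorelSpace E] [SecondCountableTopology E]
  [MeasurableSpace F] [BorelSpace F] [SecondCountableTopology F]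

/-- Applying a bounded, strongly measurable family of operators preserves integrability. -/
theorem integrable_clm_family_apply {V : α → E →L[ℝ] F} (hV : ∀ x, Measurable fun s => V s x)
    {M : ℝ} (hM : ∀ᵐ s ∂ν, ‖V s‖ ≤ M) {φ : α → E} (hφ : Integrable φ ν) :
    Integrable (fun s => V s (φ s)) ν := by
  have hunc : Measurable (Function.uncurry fun (x : E) (s : α) => V s x) :=
    measurable_uncurry_of_continuous_of_measurable (fun s => (V s).continuous) hV
  have hmeas : AEMeasurable (fun s => V s (φ s)) ν :=
    hunc.comp_aemeasurable (hφ.aestronglyMeasurable.aemeasurable.prodMk aemeasurable_id)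
  refine (hφ.norm.const_mul M).mono' hmeas.aestronglyMeasurable ?_
  filter_upwards [hM] with s hs
  exact (V s).le_of_opNorm_le hs _

/-- The operator `φ ↦ ∫ V s (φ s) ∂ν` on `L²(μ)`, for a bounded, strongly measurable family `V`
and a finite measure `ν ≤ μ`. -/
theorem exists_clm_integral_clm_family [IsFiniteMeasure ν] {μ : Measure α} (hνμ : ν ≤ μ)
    {V : α → E →L[ℝ] F} (hV : ∀ x, Measurable fun s => V s x)
    {M : ℝ} (hM0 : 0 ≤ M) (hM : ∀ᵐ s ∂ν, ‖V s‖ ≤ M) :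
    ∃ S : Lp E 2 μ →L[ℝ] F, (∀ φ, S φ = ∫ s, V s (φ s) ∂ν) ∧
      ‖S‖ ≤ M * ν.real Set.univ ^ (1 / 2 : ℝ) := by
  have hmem (φ : Lp E 2 μ) : MemLp φ 2 ν := (Lp.memLp φ).mono_measure hνμ
  have hint (φ : Lp E 2 μ) : Integrable (fun s => V s (φ s)) ν :=
    integrable_clm_family_apply hV hM ((hmem φ).integrable one_le_two)
  have hac : ν ≪ μ := Measure.absolutelyContinuous_of_le hνμ
  let L : Lp E 2 μ →ₗ[ℝ] F :=
    { toFun := fun φ => ∫ s, V s (φ s) ∂ν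
      map_add' := fun φ ψ => by
        rw [← integral_add (hint φ) (hint ψ)]
        refine integral_congr_ae ?_
        filter_upwards [hac.ae_le (Lp.coeFn_add φ ψ)] with s hs
        rw [hs, Pi.add_apply, map_add]
      map_smul' := fun c φ => by
        rw [RingHom.id_apply, ← integral_smul]
        refine integral_congr_ae ?_
        filter_upwards [hac.ae_le (Lp.coeFn_smul c φ)] with s hs
        rw [hs, Pi.smul_apply, map_smul] }
  have hL (φ : Lp E 2 μ) : ‖L φ‖ ≤ M * ν.real Set.univ ^ (1 / 2 : ℝ) * ‖φ‖ := by
    refine (norm_integral_clm_family_apply_le hM0 hM (hmem φ)).trans ?_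
    rw [mul_assoc, Lp.norm_def]
    gcongr
    · exact Lp.eLpNorm_ne_top φ
  exact ⟨L.mkContinuous _ hL, fun φ => rfl, L.mkContinuous_norm_le (by positivity) hL⟩

end OperatorFamily

/-- A strongly continuous family of operators is bounded in norm on compact sets. -/
theorem exists_norm_le_of_continuousOn_apply {X E F : Type*} [TopologicalSpace X]
    [NormedAddCommGroup E] [NormedSpace ℝ E] [CompleteSpace E]
    [NormedAddCommGroup F] [NormedSpace ℝ F] {T : X → E →L[ℝ] F} {K : Set X} (hK : IsCompact K)
    (hT : ∀ x, ContinuousOn (fun s => T s x) K) : ∃ M, 0 ≤ M ∧ ∀ s ∈ K, ‖T s‖ ≤ M := by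
  obtain ⟨M, hM⟩ := banach_steinhaus (g := fun s : K => T s) fun x => by
    obtain ⟨C, hC⟩ := hK.exists_bound_of_continuousOn (hT x)
    exact ⟨C, fun s => hC s s.2⟩
  exact ⟨max M 0, le_max_right _ _, fun s hs => (hM ⟨s, hs⟩).trans (le_max_left _ _)⟩

theorem stmt18 {H : Type*} [NormedAddCommGroup H] [InnerProductSpace ℝ H]
    [CompleteSpace H] [MeasurableSpace H] [BorelSpace H] [SecondCountableTopology H]
    (T : ℝ → H →L[ℝ] H)
    (hT0 : T 0 = ContinuousLinearMap.id ℝ H)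
    (hsem : ∀ s ≥ (0 : ℝ), ∀ t ≥ (0 : ℝ), T (s + t) = (T s).comp (T t))
    (hcont : ∀ x : H, ContinuousOn (fun s => T s x) (Set.Ici 0))
    (hcpt : ∀ t > (0 : ℝ), IsCompactOperator (T t))
    (R : (Lp H 2 (volume.restrict (Set.Ioc (0 : ℝ) 1))) →L[ℝ] H)
    (hR : ∀ φ, R φ = ∫ s in Set.Ioc (0 : ℝ) 1, T s (φ s)) :
    IsCompactOperator R := by
  obtain ⟨M, hM0, hM⟩ := exists_norm_le_of_continuousOn_apply (isCompact_Icc (a := (0 : ℝ)) (b := 1))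
    fun x => (hcont x).mono Set.Icc_subset_Ici_self
  have hmeas (ε : ℝ) (x : H) : Measurable fun s => T (max (s - ε) 0) x :=
    ((hcont x).comp_continuous (f := fun s : ℝ => max (s - ε) 0) (by fun_prop)
      fun s => Set.mem_Ici.2 (le_max_right _ _)).measurable
  have happrox : ∀ ε ∈ Set.Ioo (0 : ℝ) 1,
      ∃ S : Lp H 2 (volume.restrict (Set.Ioc (0 : ℝ) 1)) →L[ℝ] H,
      IsCompactOperator S ∧ ‖R - S‖ ≤ M * ε ^ (1 / 2 : ℝ) := by
    rintro ε ⟨hε0, hε1⟩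
    have hsub₁ : Set.Ioc ε 1 ⊆ Set.Ioc 0 1 := Set.Ioc_subset_Ioc_left hε0.le
    have hsub₂ : Set.Ioc 0 ε ⊆ Set.Ioc 0 1 := Set.Ioc_subset_Ioc_right hε1.le
    have hbound (δ a b : ℝ) (ha : δ ≤ a) (hb : b ≤ 1 + δ) :
        ∀ᵐ s ∂volume.restrict (Set.Ioc a b), ‖T (max (s - δ) 0)‖ ≤ M := by
      filter_upwards [ae_restrict_mem measurableSet_Ioc] with s hs
      exact hM _ ⟨le_max_right _ _, max_le (by linarith [hs.2]) zero_le_one⟩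
    obtain ⟨S, hS, -⟩ := exists_clm_integral_clm_family
      (Measure.restrict_mono_set volume hsub₁) (hmeas ε) hM0 (hbound ε ε 1 le_rfl (by linarith))
    obtain ⟨D, hD, hDnorm⟩ := exists_clm_integral_clm_family
      (Measure.restrict_mono_set volume hsub₂) (hmeas 0) hM0 (hbound 0 0 ε le_rfl (by linarith))
    refine ⟨(T ε).comp S, (hcpt ε hε0).comp_clm S, ?_⟩
    have hRD : R - (T ε).comp S = D := by
      ext φ
      have hφ : Integrable φ (volume.restrict (Set.Ioc (0 : ℝ) 1)) :=
        (Lp.memLp φ).integrable one_le_two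
      have hint : IntegrableOn (fun s => T (max (s - 0) 0) (φ s)) (Set.Ioc 0 1) :=
        integrable_clm_family_apply (hmeas 0) (hbound 0 0 1 le_rfl (by simp)) hφ
      have hintS : Integrable (fun s => T (max (s - ε) 0) (φ s)) (volume.restrict (Set.Ioc ε 1)) :=
        integrable_clm_family_apply (hmeas ε) (hbound ε ε 1 le_rfl (by linarith))
          (hφ.mono_measure (Measure.restrict_mono_set volume hsub₁))
      have hRφ : R φ = ∫ s in Set.Ioc (0 : ℝ) 1, T (max (s - 0) 0) (φ s) := by
        rw [hR]
        refine setIntegral_congr_fun measurableSet_Ioc fun s hs => ?_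
        simp [max_eq_left hs.1.le]
      have hTS : T ε (S φ) = ∫ s in Set.Ioc ε 1, T (max (s - 0) 0) (φ s) := by
        rw [hS, ← (T ε).integral_comp_comm hintS]
        refine setIntegral_congr_fun measurableSet_Ioc fun s hs => ?_
        have h := hsem ε hε0.le (s - ε) (sub_nonneg.2 hs.1.le)
        rw [add_sub_cancel] at h
        simp [max_eq_left (sub_nonneg.2 hs.1.le), max_eq_left (hε0.trans hs.1).le, h]
      have hsplit := setIntegral_union (Set.Ioc_disjoint_Ioc_of_le le_rfl) measurableSet_Ioc
        (hint.mono_set hsub₂) (hint.mono_set hsub₁)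
      rw [Set.Ioc_union_Ioc_eq_Ioc hε0.le hε1.le] at hsplit
      rw [sub_apply, ContinuousLinearMap.comp_apply, hTS, hRφ, hD, hsplit, add_sub_cancel_right]
    simpa [hRD, hε0.le] using hDnorm
  refine isClosed_setOfPred_isCompactOperator.closure_subset
    (Metric.mem_closure_iff.2 fun δ hδ => ?_)
  have hlim : Filter.Tendsto (fun ε : ℝ => M * ε ^ (1 / 2 : ℝ)) (nhdsWithin 0 (Set.Ioi 0))
      (nhds 0) := by
    have h : Continuous fun ε : ℝ => M * ε ^ (1 / 2 : ℝ) :=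
      continuous_const.mul (Real.continuous_rpow_const (by norm_num))
    simpa using (h.tendsto 0).mono_left nhdsWithin_le_nhds
  obtain ⟨ε, hεδ, hε⟩ :=
    ((hlim.eventually_lt_const hδ).and (Ioo_mem_nhdsGT (zero_lt_one' ℝ))).exists
  obtain ⟨S, hS, hRS⟩ := happrox ε hε
  exact ⟨S, hS, by rw [dist_eq_norm]; exact hRS.trans_lt hεδ⟩
end
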